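/- Let r ≥ 2 and let G be an r-regular graph on n vertices, each of whose connected components contains at least one cycle (which holds automatically since r ≥ 2). Then q*(G) ≥ 2/r − 2√(6/n). -/

import Mathlib

open Finset
open scoped Classical

variable {V : Type*} [Fintype V] [DecidableEq V]

/-- Number of edges of `G` inside vertex set `A` (as a real number). -/
noncomputable def eIn (G : SimpleGraph V) (A : Finset V) : ℝ :=
  (1/2) * ∑ u ∈ A, ∑ v ∈ A, if G.Adj u v then (1:ℝ) else 0

/-- Total number of edges of `G` (as a real number). -/
noncomputable def numEdges (G : SimpleGraph V) : ℝ := eIn G (univ : Finset V)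

/-- Degree of vertex `v` in `G` (as a real number). -/
noncomputable def degR (G : SimpleGraph V) (v : V) : ℝ :=
  ∑ u : V, if G.Adj v u then (1:ℝ) else 0

/-- Volume of vertex set `A`: sum of degrees of its vertices. -/
noncomputable def vol (G : SimpleGraph V) (A : Finset V) : ℝ := ∑ v ∈ A, degR G v

/-- Number of edges of `G` between `A` and its complement (as a real number). -/
noncomputable def eCross (G : SimpleGraph V) (A : Finset V) : ℝ :=
  ∑ u ∈ A, ∑ v ∈ (univ : Finset V) \ A, if G.Adj u v then (1:ℝ) else 0

/-- The modularity score of a vertex partition `P` of `G`. -/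
noncomputable def modScore (G : SimpleGraph V) (P : Finpartition (univ : Finset V)) : ℝ :=
  (∑ A ∈ P.parts, eIn G A) / numEdges G
    - (∑ A ∈ P.parts, (vol G A)^2) / (4 * (numEdges G)^2)

/-- The modularity of `G`: the supremum of modularity scores over all vertex partitions. -/
noncomputable def modularity (G : SimpleGraph V) : ℝ :=
  sSup { q : ℝ | ∃ P : Finpartition (univ : Finset V), q = modScore G P }

lemma cluster {V : Type*} [Fintype V] [DecidableEq V] (rt p : V → V) (d : V → ℕ)
    (hp : ∀ v, v ≠ rt v → d (p v) < d v ∧ rt (p v) = rt v) (t r : ℕ)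
    (hr : ∀ u, (univ.filter (fun c => c ≠ rt c ∧ p c = u)).card ≤ r) :
    ∃ h : V → V, (∀ u, h u ≠ u → u ≠ rt u ∧ h u = h (p u)) ∧ (∀ u, rt (h u) = rt u) ∧
      (∀ u x, u ≠ rt u → h x = u → t + 1 ≤ (univ.filter (fun x => h x = u)).card) ∧
      ∀ u, (univ.filter (fun x => h x = u)).card ≤ 1 + r * t := by
  have key : ∀ S : Finset V, (∀ v ∈ S, v ≠ rt v) → 
    ∃ h : V → V, (∀ u, u ∉ S → h u = u) ∧ (∀ u, h u ≠ u → h u = h (p u)) ∧ (∀ u, rt (h u) = rt u) ∧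
      (∀ u x, u ∈ S → h x = u → t + 1 ≤ (univ.filter (fun x => h x = u)).card) ∧
      ∀ u, (univ.filter (fun x => h x = u)).card ≤ 1 + (S.filter (fun c => p c = u)).card * t := by
    intro S
    induction S using Finset.induction_on_min_value d with
    | empty => 
      intro _
      refine ⟨id, by simp, by simp, by simp, by simp, ?_⟩
      intro u
      simp [Finset.filter_eq']
    | insert v S hv hmin ih =>
      intro hS
      obtain ⟨h, h1, h2, h3, h4, h5⟩ := ih (fun x hx => hS x (mem_insert_of_mem hx))
      have hvr := hS v (mem_insert_self _ _)
      obtain ⟨hd, hrt⟩ := hp v hvr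
      have hpv : p v ∉ S := fun hh => by have := hmin _ hh; omega
      have hpvne : p v ≠ v := fun hh => by rw [hh] at hd; omega
      by_cases hc : t + 1 ≤ (univ.filter (fun x => h x = v)).card
      · refine ⟨h, ?_, h2, h3, ?_, ?_⟩
        · intro u hu
          exact h1 u (fun hh => hu (mem_insert_of_mem hh))
        · intro u x hu hx
          rcases mem_insert.1 hu with rfl | hu
          · exact hc
          · exact h4 u x hu hx
        · intro u
          refine (h5 u).trans ?_
          gcongr
          exact subset_insert _ _
      · let h' : V → V := fun x => if h x = v then p v else h x
        have e' : ∀ x, h' x = if h x = v then p v else h x := fun x => rfl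
        refine ⟨h', ?_, ?_, ?_, ?_, ?_⟩
        · intro u hu
          simp only [mem_insert, not_or] at hu
          rw [e', h1 u hu.2, if_neg hu.1]
        · intro u hu
          by_cases huv : u = v
          · subst huv
            rw [e', e', h1 _ hv, h1 _ hpv]; simp
          · by_cases hh : h u = u
            · rw [e', hh, if_neg huv] at hu; exact absurd rfl hu
            · rw [e', e', h2 u hh]
        · intro u
          rw [e']
          split_ifs with hh
          · rw [hrt, ← hh, h3]
          · exact h3 u
        · intro u x hu hx
          by_cases huv : u = v
          · subst huv
            rw [e'] at hx
            split_ifs at hx with hh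
            · exact absurd hx hpvne
            · exact absurd hx hh
          · have huS : u ∈ S := (mem_insert.1 hu).resolve_left huv
            have hup : p v ≠ u := fun hh => hpv (hh ▸ huS)
            have : ∀ y, h' y = u ↔ h y = u := by
              intro y
              rw [e']
              split_ifs with hh
              · simp [hup, hh, Ne.symm huv]
              · rfl
            simp only [this] at hx ⊢
            exact h4 u x huS hx
        · intro u
          by_cases hup : u = p v
          · subst hup
            have e1 : univ.filter (fun x => h' x = p v) ⊆
                univ.filter (fun x => h x = p v) ∪ univ.filter (fun x => h x = v) := by
              intro y
              simp only [mem_filter, mem_union, mem_univ, true_and, e']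
              split_ifs with hh <;> tauto
            have e2 := (card_le_card e1).trans (card_union_le _ _)
            have e3 := h5 (p v)
            have e4 : ((insert v S).filter (fun c => p c = p v)).card
                = (S.filter (fun c => p c = p v)).card + 1 := by
              rw [filter_insert, if_pos rfl, card_insert_of_notMem]
              simp [hv]
            rw [e4, add_mul]
            omega
          · have e1 : univ.filter (fun x => h' x = u) ⊆ univ.filter (fun x => h x = u) := by
              intro y
              simp only [mem_filter, mem_univ, true_and, e']
              split_ifs with hh
              · intro h; exact absurd h.symm hup
              · exact id
            refine (card_le_card e1).trans ((h5 u).trans ?_)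
            gcongr
            exact subset_insert _ _
  obtain ⟨h, h1, h2, h3, h4, h5⟩ := key (univ.filter (fun v => v ≠ rt v)) (by simp)
  refine ⟨h, ?_, h3, ?_, ?_⟩
  · intro u hu
    refine ⟨fun hh => hu (h1 u (by simpa using hh)), h2 u hu⟩
  · intro u x hu hx
    exact h4 u x (by simpa using hu) hx
  · intro u
    refine (h5 u).trans ?_
    rw [filter_filter]
    gcongr
    exact hr u

lemma roots (G : SimpleGraph V) : ∃ (rt p : V → V) (d : V → ℕ),
    (∀ v, v ≠ rt v → d (p v) < d v ∧ rt (p v) = rt v) ∧ (∀ v, v ≠ rt v → G.Adj v (p v)) ∧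
    (∀ u v, G.Adj u v → rt u = rt v) ∧ ∀ v, rt (rt v) = rt v := by
  let rt : V → V := fun v => (G.connectedComponentMk v).out
  have hrt : ∀ v, G.connectedComponentMk (rt v) = G.connectedComponentMk v := fun v =>
    Quot.out_eq _
  have hadj : ∀ u v, G.Adj u v → rt u = rt v := by
    intro u v huv
    have : G.connectedComponentMk u = G.connectedComponentMk v :=
      SimpleGraph.ConnectedComponent.sound huv.reachable
    simp only [rt, this]
  have hex : ∀ v, ∃ w, v ≠ rt v → G.Adj v w ∧ G.dist w (rt w) < G.dist v (rt v) := by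
    intro v
    by_cases hv : v = rt v
    · exact ⟨v, fun h => absurd hv h⟩
    have hre : G.Reachable v (rt v) := SimpleGraph.ConnectedComponent.exact (hrt v).symm
    obtain ⟨w, hw⟩ := hre.exists_walk_length_eq_dist
    generalize hx : rt v = x at *
    cases w with
    | nil => exact absurd rfl hv
    | cons ha w' =>
      rename_i b
      refine ⟨b, fun _ => ⟨ha, ?_⟩⟩
      rw [← hadj _ _ ha, hx, ← hw]
      have := SimpleGraph.dist_le w'
      simp only [SimpleGraph.Walk.length_cons]
      omega
  choose p hp using hex
  refine ⟨rt, p, fun v => G.dist v (rt v), fun v hv => ⟨(hp v hv).2, (hadj _ _ (hp v hv).1).symm⟩,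
    fun v hv => (hp v hv).1, hadj, fun v => ?_⟩
  simp only [rt]
  exact congrArg _ (hrt v)

lemma exists_cluster (G : SimpleGraph V) (r t : ℕ) (hr : 2 ≤ r)
    (hdeg : ∀ v, (univ.filter (fun u => G.Adj v u)).card = r) :
    ∃ h : V → V, (∀ u, (univ.filter (fun x => h x = u)).card ≤ 1 + r * t) ∧
      ∃ H : ℕ, (t + 1) * H ≤ 2 * Fintype.card V ∧
        2 * Fintype.card V ≤
          (univ.filter (fun q : V × V => G.Adj q.1 q.2 ∧ h q.1 = h q.2)).card + 2 * H := by
  obtain ⟨rt, p, d, hp, hpa, hadj, hrr⟩ := roots G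
  obtain ⟨h, h1, h2, h3, h4⟩ := cluster rt p d hp t r (by
    intro u
    rw [← hdeg u]
    apply card_le_card
    intro c
    simp only [mem_filter, mem_univ, true_and]
    rintro ⟨hc, rfl⟩
    exact (hpa c hc).symm)
  refine ⟨h, h4, ?_⟩
  -- the component of `u`
  let C : V → Finset V := fun u => univ.filter (fun x => rt x = rt u)
  have hC : ∀ u, C u = univ.filter (fun x => rt x = rt u) := fun u => rfl
  have hCe : ∀ u v, rt u = rt v → C u = C v := fun u v e => by rw [hC, hC, e]
  let Sm : Finset V := univ.filter (fun u => (C u).card ≤ t)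
  let NH : Finset V := univ.filter (fun u => ¬ (C u).card ≤ t ∧ h u ≠ u)
  let H1 : Finset V := univ.filter (fun u => u ≠ rt u ∧ h u = u)
  let H2 : Finset V := univ.filter (fun u => ¬ (C u).card ≤ t ∧ u = rt u)
  have hsmall : ∀ u, (C u).card ≤ t → h u = rt u := by
    intro u hu
    by_contra hne
    have e : h u ≠ rt (h u) := by rw [h2]; exact hne
    have := h3 (h u) u e rfl
    have h5 : (univ.filter (fun x => h x = h u)).card ≤ (C u).card := by
      apply card_le_card
      intro x
      simp only [C, mem_filter, mem_univ, true_and]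
      intro hx
      rw [← h2 x, hx, h2]
    omega
  have cover : Fintype.card V ≤ Sm.card + NH.card + (H1.card + H2.card) := by
    have : (univ : Finset V) ⊆ (Sm ∪ NH) ∪ (H1 ∪ H2) := by
      intro u _
      simp only [Sm, NH, H1, H2, mem_union, mem_filter, mem_univ, true_and]
      tauto
    calc Fintype.card V = (univ : Finset V).card := rfl
      _ ≤ _ := card_le_card this
      _ ≤ _ := card_union_le _ _
      _ ≤ _ := add_le_add (card_union_le _ _) (card_union_le _ _)
  have hH1 : (t + 1) * H1.card ≤ Fintype.card V := by
    calc (t + 1) * H1.card = ∑ u ∈ H1, (t + 1) := by simp [mul_comm]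
      _ ≤ ∑ u ∈ H1, (univ.filter (fun x => h x = u)).card := by
          apply sum_le_sum
          intro u hu
          simp only [H1, mem_filter, mem_univ, true_and] at hu
          exact h3 u u hu.1 hu.2
      _ ≤ ∑ u : V, (univ.filter (fun x => h x = u)).card :=
          sum_le_sum_of_subset (subset_univ _)
      _ = Fintype.card V := (card_eq_sum_card_fiberwise (by simp)).symm
  have hH2 : (t + 1) * H2.card ≤ Fintype.card V := by
    calc (t + 1) * H2.card = ∑ u ∈ H2, (t + 1) := by simp [mul_comm]
      _ ≤ ∑ u ∈ H2, (univ.filter (fun x => rt x = u)).card := by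
          apply sum_le_sum
          intro u hu
          simp only [H2, mem_filter, mem_univ, true_and] at hu
          have := hu.1
          rw [hC, ← hu.2] at this
          omega
      _ ≤ ∑ u : V, (univ.filter (fun x => rt x = u)).card :=
          sum_le_sum_of_subset (subset_univ _)
      _ = Fintype.card V := (card_eq_sum_card_fiberwise (by simp)).symm
  refine ⟨H1.card + H2.card, by rw [mul_add]; omega, ?_⟩
  let A1 : Finset (V × V) := univ.filter (fun q : V × V => (C q.1).card ≤ t ∧ G.Adj q.1 q.2)
  let A2 : Finset (V × V) := NH.image (fun u => (u, p u))
  let A3 : Finset (V × V) := NH.image (fun u => (p u, u))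
  have c1 : 2 * Sm.card ≤ A1.card := by
    have : A1.card = ∑ u ∈ Sm, (A1.filter (fun q => q.1 = u)).card := by
      apply card_eq_sum_card_fiberwise
      intro q
      simp only [A1, Sm, coe_filter, Set.mem_ofPred_eq, mem_univ, true_and]
      exact fun h => h.1
    rw [this, mul_comm, ← smul_eq_mul, ← sum_const]
    apply sum_le_sum
    intro u hu
    simp only [Sm, mem_filter, mem_univ, true_and] at hu
    refine hr.trans ?_
    rw [← hdeg u]
    apply card_le_card_of_injOn (fun v => (u, v))
    · intro v
      simp only [A1, coe_filter, Set.mem_ofPred_eq, mem_filter, mem_univ, true_and]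
      exact fun hv => ⟨⟨hu, hv⟩, trivial⟩
    · intro a _ b _ hab
      simpa using hab
  have c2 : A2.card = NH.card := card_image_of_injective _ (fun a b hab => (Prod.mk.inj hab).1)
  have c3 : A3.card = NH.card := card_image_of_injective _ (fun a b hab => (Prod.mk.inj hab).2)
  have hNH : ∀ u ∈ NH, ¬ (C u).card ≤ t ∧ u ≠ rt u ∧ h u = h (p u) := by
    intro u hu
    simp only [NH, mem_filter, mem_univ, true_and] at hu
    exact ⟨hu.1, h1 u hu.2⟩
  have d23 : Disjoint A2 A3 := by
    rw [disjoint_left]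
    intro q hq hq'
    simp only [A2, A3, mem_image] at hq hq'
    obtain ⟨a, ha, rfl⟩ := hq
    obtain ⟨b, hb, hab⟩ := hq'
    obtain ⟨e1, e2⟩ := Prod.mk.inj hab
    have := (hp a (hNH a ha).2.1).1
    have := (hp b (hNH b hb).2.1).1
    rw [e1, e2] at this
    omega
  have d1 : Disjoint A1 (A2 ∪ A3) := by
    rw [disjoint_left]
    intro q hq hq'
    simp only [A1, A2, A3, mem_image, mem_union, mem_filter, mem_univ, true_and] at hq hq'
    rcases hq' with ⟨a, ha, rfl⟩ | ⟨a, ha, rfl⟩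
    · exact (hNH a ha).1 hq.1
    · have := hq.1
      simp only at this
      rw [hCe _ _ (hp a (hNH a ha).2.1).2] at this
      exact (hNH a ha).1 this
  have sub : A1 ∪ (A2 ∪ A3) ⊆ univ.filter (fun q : V × V => G.Adj q.1 q.2 ∧ h q.1 = h q.2) := by
    intro q hq
    simp only [A1, A2, A3, mem_image, mem_union, mem_filter, mem_univ, true_and] at hq ⊢
    rcases hq with ⟨ha, hb⟩ | ⟨a, ha, rfl⟩ | ⟨a, ha, rfl⟩
    · have e := hadj _ _ hb
      refine ⟨hb, ?_⟩
      rw [hsmall _ ha, hsmall q.2 (by rw [← hCe _ _ e]; exact ha), e]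
    · exact ⟨hpa a (hNH a ha).2.1, (hNH a ha).2.2⟩
    · exact ⟨(hpa a (hNH a ha).2.1).symm, (hNH a ha).2.2.symm⟩
  have := card_le_card sub
  rw [card_union_of_disjoint d1, card_union_of_disjoint d23] at this
  omega

lemma sum_parts (P : Finpartition (univ : Finset V)) (f : V → ℝ) :
    ∑ A ∈ P.parts, ∑ u ∈ A, f u = ∑ u, f u := by
  have e := P.sup_parts
  rw [sup_eq_biUnion] at e
  have e2 := Finset.sum_biUnion (f := f) P.disjoint
  rw [e] at e2
  exact e2.symm

lemma score_bound (G : SimpleGraph V) (r : ℕ) (hr : 2 ≤ r) (hn : 0 < Fintype.card V)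
    (hdeg : ∀ v, (univ.filter (fun u => G.Adj v u)).card = r) (h : V → V) (M : ℕ)
    (hM : ∀ u, (univ.filter (fun x => h x = u)).card ≤ M) :
    ∃ P : Finpartition (univ : Finset V),
      ((univ.filter (fun q : V × V => G.Adj q.1 q.2 ∧ h q.1 = h q.2)).card : ℝ)
        / (r * Fintype.card V) - M / Fintype.card V ≤ modScore G P := by
  have hdR : ∀ v, degR G v = r := by
    intro v
    rw [degR, ← hdeg v]
    simp
  have hvol : ∀ A, vol G A = r * A.card := by
    intro A
    simp [vol, hdR, mul_comm]
  have hm : numEdges G = r * Fintype.card V / 2 := by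
    have := hvol univ
    simp only [vol, degR] at this
    rw [numEdges, eIn, this, card_univ]
    ring
  let P := Finpartition.ofSetoid (Setoid.ker h)
  have hP : ∀ A ∈ P.parts, ∀ u ∈ A, A = univ.filter (fun x => h x = h u) := by
    intro A hA u hu
    rw [← P.part_eq_of_mem hA hu]
    ext x
    rw [Finpartition.mem_part_ofSetoid_iff_rel]
    simp [Setoid.ker_def, eq_comm]
  have hE : ∑ A ∈ P.parts, eIn G A =
      (1/2) * ((univ.filter (fun q : V × V => G.Adj q.1 q.2 ∧ h q.1 = h q.2)).card : ℝ) := by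
    simp only [eIn]
    rw [← mul_sum]
    congr 1
    have : ∑ A ∈ P.parts, ∑ u ∈ A, ∑ v ∈ A, (if G.Adj u v then (1:ℝ) else 0)
        = ∑ A ∈ P.parts, ∑ u ∈ A, ∑ v, (if G.Adj u v ∧ h u = h v then (1:ℝ) else 0) := by
      apply sum_congr rfl
      intro A hA
      apply sum_congr rfl
      intro u hu
      conv_lhs => rw [hP A hA u hu]
      rw [sum_filter]
      apply sum_congr rfl
      intro v _
      by_cases e : h u = h v
      · simp [e]
      · simp [e, Ne.symm e]
    rw [this, sum_parts, card_filter, Nat.cast_sum, ← univ_product_univ, sum_product]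
    simp
  have hS : ∑ A ∈ P.parts, (vol G A)^2 ≤ r^2 * (M * Fintype.card V) := by
    simp only [hvol, mul_pow]
    rw [← mul_sum]
    gcongr
    calc ∑ A ∈ P.parts, (A.card : ℝ)^2 = ∑ A ∈ P.parts, ∑ u ∈ A, (A.card : ℝ) := by
          simp [sq]
      _ ≤ ∑ A ∈ P.parts, ∑ u ∈ A, (M : ℝ) := by
          apply sum_le_sum
          intro A hA
          apply sum_le_sum
          intro u hu
          rw [hP A hA u hu]
          exact_mod_cast hM _
      _ = M * Fintype.card V := by rw [sum_parts]; simp [mul_comm]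
  refine ⟨P, ?_⟩
  have hn' : (0:ℝ) < Fintype.card V := by exact_mod_cast hn
  have hr' : (0:ℝ) < r := by exact_mod_cast (by omega : 0 < r)
  rw [modScore, hE, hm]
  apply sub_le_sub
  · apply le_of_eq; field_simp
  · rw [div_le_div_iff₀ (by positivity) (by positivity)]
    calc _ ≤ (r^2 * (M * Fintype.card V)) * (Fintype.card V : ℝ) := by gcongr
      _ = _ := by ring

/-- every `r`-regular graph (`r ≥ 2`) on `n` vertices has modularity at
least `2/r - 2√(6/n)`. -/
theorem modularity_regular_lower (G : SimpleGraph V) (r : ℕ) (hr : 2 ≤ r)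
    (hreg : G.IsRegularOfDegree r) (hn : 0 < Fintype.card V) :
    2 / (r : ℝ) - 2 * Real.sqrt (6 / (Fintype.card V : ℝ)) ≤ modularity G := by

  have hdeg : ∀ v, (univ.filter (fun u => G.Adj v u)).card = r := by
    intro v
    rw [← hreg v, ← SimpleGraph.card_neighborFinset_eq_degree]
    congr 1
    ext u
    simp
  have hle : ∀ P : Finpartition (univ : Finset V), modScore G P ≤ modularity G := by
    intro P
    refine le_csSup ?_ ⟨P, rfl⟩
    have : {q : ℝ | ∃ P : Finpartition (univ : Finset V), q = modScore G P}
        = Set.range (modScore G) := by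
      ext q; simp [eq_comm]
    rw [this]
    exact (Set.finite_range _).bddAbove
  have hn' : (0:ℝ) < Fintype.card V := by exact_mod_cast hn
  have hr' : (0:ℝ) < r := by exact_mod_cast (by omega : 0 < r)
  set n : ℝ := (Fintype.card V : ℝ) with hnd
  set a := Real.sqrt (6 / n) with ha
  have ha2 : a ^ 2 = 6 / n := Real.sq_sqrt (by positivity)
  have ha0 : 0 < a := Real.sqrt_pos.2 (by positivity)
  by_cases hbig : 1 < r * a
  · obtain ⟨v₀⟩ : Nonempty V := Fintype.card_pos_iff.1 hn
    obtain ⟨P, hP⟩ := score_bound G r hr hn hdeg (fun _ => v₀) (Fintype.card V)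
      (fun u => card_le_univ _)
    refine le_trans ?_ (hP.trans (hle P))
    have e : ((univ.filter (fun q : V × V => G.Adj q.1 q.2 ∧ v₀ = v₀)).card : ℝ) = n * r := by
      simp only [and_true]
      rw [card_filter, Nat.cast_sum, ← univ_product_univ, sum_product]
      have : ∀ v, ∑ u, (((if G.Adj v u then 1 else 0 : ℕ)) : ℝ) = r := by
        intro v
        rw [← hdeg v, card_filter, Nat.cast_sum]
      simp only [this]
      simp [hnd]
    rw [e]
    have h1 : n * r / (r * n) - n / n = 0 := by field_simp; simp
    rw [← hnd, h1]
    have : 2 / (r:ℝ) ≤ 2 * a := by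
      rw [div_le_iff₀ hr']; nlinarith
    linarith
  · push Not at hbig
    have hra : 0 < r * a := by positivity
    obtain ⟨s, hs1, hs2⟩ : ∃ s : ℕ, 3 / (r * a) ≤ s ∧ (s : ℝ) < 3 / (r * a) + 1 :=
      ⟨_, Nat.le_ceil _, Nat.ceil_lt_add_one (by positivity)⟩
    have hs0 : 0 < s := by
      have : (0:ℝ) < s := lt_of_lt_of_le (by positivity) hs1
      exact_mod_cast this
    obtain ⟨t, rfl⟩ : ∃ t, s = t + 1 := ⟨s - 1, by omega⟩
    obtain ⟨h, hM, H, hH, hE⟩ := exists_cluster G r t hr hdeg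
    obtain ⟨P, hP⟩ := score_bound G r hr hn hdeg h _ hM
    refine le_trans ?_ (hP.trans (hle P))
    rw [← hnd]
    generalize (univ.filter (fun q : V × V => G.Adj q.1 q.2 ∧ h q.1 = h q.2)).card = E at hE
    have hE' : 2 * n ≤ E + 2 * H := by rw [hnd]; exact_mod_cast hE
    have hH' : ((t + 1 : ℕ) : ℝ) * H ≤ 2 * n := by rw [hnd]; exact_mod_cast hH
    have hMx : ((1 + r * t : ℕ) : ℝ) ≤ r * (t + 1 : ℕ) := by
      have : 1 + r * t ≤ r * (t + 1) := by rw [mul_add]; omega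
      exact_mod_cast this
    generalize ((1 + r * t : ℕ) : ℝ) = M at hMx
    have hs0' : (0:ℝ) < ((t + 1 : ℕ) : ℝ) := by exact_mod_cast hs0
    generalize ((t + 1 : ℕ) : ℝ) = s at *
    have y1 : 3 ≤ s * (r * a) := by rwa [div_le_iff₀ hra] at hs1
    have y2 : s * (r * a) ≤ 4 := by
      have : s * (r * a) < (3 / (r * a) + 1) * (r * a) := by gcongr
      rw [add_mul, div_mul_cancel₀ _ hra.ne'] at this
      linarith
    have hn2 : n = 6 / a ^ 2 := by rw [ha2]; field_simp
    have b1 : 2 / (r:ℝ) - 4 / (r * s) ≤ E / (r * n) := by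
      have : (H:ℝ) ≤ 2 * n / s := by rw [le_div_iff₀ hs0']; linarith
      rw [le_div_iff₀ (by positivity)]
      have e : (2 / (r:ℝ) - 4 / (r * s)) * (r * n) = 2 * n - 2 * (2 * n / s) := by
        field_simp; ring
      rw [e]; linarith
    have b2 : M / n ≤ r * s * (a^2 / 6) := by
      rw [ha2]
      have : r * s * (6 / n / 6) = r * s / n := by field_simp
      rw [this]; gcongr
    have b3 : 4 / (r * s) + r * s * (a^2/6) ≤ 2 * a := by
      have hx : 0 < r * s := by positivity
      have : 4 / (r * s) ≤ 2 * a - r * s * (a^2/6) := by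
        rw [div_le_iff₀ hx]
        nlinarith [mul_nonneg (sub_nonneg.2 y1) (sub_nonneg.2 y2)]
      linarith
    linarith
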